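/- Let A be a positive semidefinite n×n complex matrix, let Z be an expansive n×n matrix (Z*Z ≥ I), and let β ≥ 0. Then there exists an n×n unitary matrix U such that Z* (A − βI)_+ Z ≤ U (Z*AZ − βI)_+ U* in the Loewner order, where for a Hermitian matrix S, S_+ denotes its positive part (obtained by applying t ↦ max(t,0) to S). -/

import Mathlib

open Matrix ComplexOrder

/-- Functional calculus: apply `f : ℝ → ℝ` to a Hermitian matrix via its spectral
decomposition `A = Σ λ_k u_k u_k*`, i.e. `f(A) = Σ f(λ_k) u_k u_k*`;
junk value `0` if the matrix is not Hermitian. -/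
noncomputable def matFun {n : ℕ} (A : Matrix (Fin n) (Fin n) ℂ) (f : ℝ → ℝ) :
    Matrix (Fin n) (Fin n) ℂ :=
  if h : A.IsHermitian then
    (h.eigenvectorUnitary : Matrix (Fin n) (Fin n) ℂ) *
      Matrix.diagonal (fun i => (f (h.eigenvalues i) : ℂ)) *
      star (h.eigenvectorUnitary : Matrix (Fin n) (Fin n) ℂ)
  else 0

namespace Matrix

variable {n : ℕ}

/-- The conjugate transpose of an expansive matrix is expansive. -/
theorem PosSemidef.mul_conjTranspose_sub_one {Z : Matrix (Fin n) (Fin n) ℂ}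
    (hZ : (Zᴴ * Z - 1).PosSemidef) : (Z * Zᴴ - 1).PosSemidef := by
  have hdef : (Zᴴ * Z).PosDef := by
    simpa using PosDef.posSemidef_add hZ (PosDef.one (n := Fin n) (R := ℂ))
  have hu : IsUnit Z := by
    have h := (isUnit_iff_isUnit_det _).1 hdef.isUnit
    rw [det_mul] at h
    exact (isUnit_iff_isUnit_det _).2 (isUnit_of_mul_isUnit_right h)
  obtain ⟨Y, hZY⟩ := hu.exists_right_inv
  have hZYs : Yᴴ * Zᴴ = 1 := by rw [← conjTranspose_mul, hZY, conjTranspose_one]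
  have h1 : (1 - Yᴴ * Y).PosSemidef := by
    convert hZ.conjTranspose_mul_mul_same Y using 1
    simp only [mul_sub, sub_mul, mul_one]
    rw [← mul_assoc Yᴴ, hZYs, one_mul, hZY]
  have h2 : (1 - Y * Yᴴ).PosSemidef := by
    convert (posSemidef_conjTranspose_mul_self (1 - Y * Yᴴ)).add
      (h1.mul_mul_conjTranspose_same Y) using 1
    simp only [conjTranspose_sub, conjTranspose_one, conjTranspose_mul, conjTranspose_conjTranspose]
    noncomm_ring
  convert h2.mul_mul_conjTranspose_same Z using 1
  rw [mul_sub, sub_mul, mul_one, ← mul_assoc, hZY, one_mul, hZYs]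

/-- A subspace-intersection argument: a unitary `T` sends some nonzero vector supported on an
initial segment to one vanishing on the corresponding strict initial segment. -/
theorem exists_ne_zero_mulVec_eq_zero {m : ℕ} (T : Matrix (Fin n) (Fin n) ℂ)
    (σ : Fin n ≃ Fin m) (i : Fin n) :
    ∃ a : Fin n → ℂ, a ≠ 0 ∧ (∀ k, σ i < σ k → a k = 0) ∧ ∀ k, σ k < σ i → (T *ᵥ a) k = 0 := by
  let ext : ({k // σ k ≤ σ i} → ℂ) →ₗ[ℂ] (Fin n → ℂ) :=
    Function.ExtendByZero.linearMap ℂ Subtype.val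
  let f : ({k // σ k ≤ σ i} → ℂ) →ₗ[ℂ] ({k // σ k < σ i} → ℂ) :=
    LinearMap.funLeft ℂ ℂ Subtype.val ∘ₗ T.mulVecLin ∘ₗ ext
  have hcard : Fintype.card {k // σ k < σ i} < Fintype.card {k // σ k ≤ σ i} := by
    rw [Fintype.card_subtype, Fintype.card_subtype]
    refine Finset.card_lt_card (Finset.ssubset_iff_of_subset ?_ |>.2 ⟨i, by simp, by simp⟩)
    exact fun k hk => by simpa using (by simpa using hk : σ k < σ i).le
  obtain ⟨c, hc, hc0⟩ := Submodule.exists_mem_ne_zero_of_ne_bot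
    (LinearMap.ker_ne_bot_of_finrank_lt (f := f) (by simpa using hcard))
  refine ⟨ext c, fun h => hc0 ?_, fun k hk => ?_, fun k hk => congr_fun hc ⟨k, hk⟩⟩
  · ext k
    have := congr_fun h k
    simpa [ext, Subtype.val_injective.extend_apply] using this
  · refine Function.extend_apply' _ _ _ ?_
    rintro ⟨⟨j, hj⟩, rfl⟩
    exact absurd hj hk.not_ge

/-- Weyl-type comparison of a weight `p` with a weight `d`. -/
theorem le_of_posSemidef_diagonal_sub {m : ℕ} {T : Matrix (Fin n) (Fin n) ℂ} (hT : Tᴴ * T = 1)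
    (σ : Fin n ≃ Fin m) {p d : Fin n → ℝ} (hp : ∀ j k, σ j ≤ σ k → p k ≤ p j)
    (hd : ∀ j k, σ j ≤ σ k → d k ≤ d j)
    (h : (diagonal (fun k => (p k : ℂ)) * (Tᴴ * diagonal (fun k => (d k : ℂ)) * T -
      diagonal (fun k => (p k : ℂ))) * diagonal (fun k => (p k : ℂ))).PosSemidef)
    {i : Fin n} (hi : 0 < p i) : p i ≤ d i := by
  obtain ⟨a, ha0, ha, hTa⟩ := exists_ne_zero_mulVec_eq_zero T σ i
  have hquad (q : Fin n → ℝ) (x : Fin n → ℂ) :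
      star x ⬝ᵥ (diagonal (fun k => (q k : ℂ)) *ᵥ x) = ((∑ k, q k * ‖x k‖ ^ 2 : ℝ) : ℂ) := by
    simp only [dotProduct, mulVec_diagonal, Pi.star_apply, Complex.ofReal_sum]
    refine Finset.sum_congr rfl fun k _ => ?_
    push_cast
    rw [← Complex.conj_mul']
    simp only [RCLike.star_def]
    ring
  have hnorm : ∑ k, ‖(T *ᵥ a) k‖ ^ 2 = ∑ k, ‖a k‖ ^ 2 := by
    have h1 := hquad 1 (T *ᵥ a)
    have h2 := hquad 1 a
    simp only [Pi.one_apply, Complex.ofReal_one, diagonal_one, one_mulVec, one_mul] at h1 h2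
    rw [star_mulVec, ← dotProduct_mulVec, mulVec_mulVec, hT, one_mulVec, h2] at h1
    exact_mod_cast h1.symm
  have hmul : diagonal (fun k => (p k : ℂ)) *ᵥ (fun k => a k / p k) = a := by
    ext k
    rw [mulVec_diagonal]
    rcases lt_or_ge (σ i) (σ k) with hk | hk
    · simp [ha k hk]
    · have : (p k : ℂ) ≠ 0 := by exact_mod_cast (hi.trans_le (hp _ _ hk)).ne'
      field_simp
  have key : ∑ k, p k * ‖a k‖ ^ 2 ≤ ∑ k, d k * ‖(T *ᵥ a) k‖ ^ 2 := by
    have h1 := h.dotProduct_mulVec_nonneg (fun k => a k / p k)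
    have hD : (diagonal (fun k => (p k : ℂ)))ᴴ = diagonal (fun k => (p k : ℂ)) := by
      simp [diagonal_conjTranspose, Pi.star_def]
    rw [← mulVec_mulVec, hmul, ← mulVec_mulVec, dotProduct_mulVec, ← hD, ← star_mulVec, hmul,
      hD, sub_mulVec, dotProduct_sub, hquad, ← mulVec_mulVec, ← mulVec_mulVec, dotProduct_mulVec,
      ← star_mulVec, hquad] at h1
    exact_mod_cast sub_nonneg.1 h1
  have hpos : 0 < ∑ k, ‖a k‖ ^ 2 := by
    obtain ⟨k, hk⟩ := Function.ne_iff.1 ha0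
    exact Finset.sum_pos' (fun _ _ => by positivity)
      ⟨k, Finset.mem_univ _, pow_pos (norm_pos_iff.2 hk) 2⟩
  refine le_of_mul_le_mul_right ?_ hpos
  calc p i * ∑ k, ‖a k‖ ^ 2 ≤ ∑ k, p k * ‖a k‖ ^ 2 := by
        rw [Finset.mul_sum]
        refine Finset.sum_le_sum fun k _ => ?_
        rcases lt_or_ge (σ i) (σ k) with hk | hk
        · simp [ha k hk]
        · exact mul_le_mul_of_nonneg_right (hp _ _ hk) (by positivity)
    _ ≤ ∑ k, d k * ‖(T *ᵥ a) k‖ ^ 2 := key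
    _ ≤ d i * ∑ k, ‖(T *ᵥ a) k‖ ^ 2 := by
        rw [Finset.mul_sum]
        refine Finset.sum_le_sum fun k _ => ?_
        rcases lt_or_ge (σ k) (σ i) with hk | hk
        · simp [hTa k hk]
        · exact mul_le_mul_of_nonneg_right (hd _ _ hk) (by positivity)
    _ = d i * ∑ k, ‖a k‖ ^ 2 := by rw [hnorm]

theorem IsHermitian.eigenvalues_le_of_le {A : Matrix (Fin n) (Fin n) ℂ} (hA : A.IsHermitian)
    {j k : Fin n} (h : (Fintype.equivOfCardEq (Fintype.card_fin _)).symm j ≤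
      ((Fintype.equivOfCardEq (Fintype.card_fin _)).symm k : Fin (Fintype.card (Fin n)))) :
    hA.eigenvalues k ≤ hA.eigenvalues j :=
  hA.eigenvalues₀_antitone h

theorem IsHermitian.eq_mul_diagonal_mul {A : Matrix (Fin n) (Fin n) ℂ} (hA : A.IsHermitian) :
    A = (hA.eigenvectorUnitary : Matrix (Fin n) (Fin n) ℂ) *
      diagonal (fun i => (hA.eigenvalues i : ℂ)) *
      (hA.eigenvectorUnitary : Matrix (Fin n) (Fin n) ℂ)ᴴ := by
  conv_lhs => rw [hA.spectral_theorem]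
  rfl

theorem IsHermitian.conjTranspose_eigenvectorUnitary_mul_self {A : Matrix (Fin n) (Fin n) ℂ}
    (hA : A.IsHermitian) : (hA.eigenvectorUnitary : Matrix (Fin n) (Fin n) ℂ)ᴴ *
      (hA.eigenvectorUnitary : Matrix (Fin n) (Fin n) ℂ) = 1 :=
  Unitary.coe_star_mul_self _

theorem posSemidef_diagonal_ofReal {q : Fin n → ℝ} (hq : ∀ i, 0 ≤ q i) :
    (diagonal (fun i => (q i : ℂ))).PosSemidef :=
  PosSemidef.diagonal fun i => Complex.zero_le_real.2 (hq i)

/-- If `S` dominates `H ≥ 0` on the range of `H`, then `H` is dominated by a unitary conjugate of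
the positive part of `S`. -/
theorem exists_unitary_conj_posPart_sub {S H : Matrix (Fin n) (Fin n) ℂ} (hS : S.IsHermitian)
    (hH : H.PosSemidef) (h : (H * (S - H) * H).PosSemidef) :
    ∃ U : Matrix (Fin n) (Fin n) ℂ, Uᴴ * U = 1 ∧
      (U * matFun S (fun t => max t 0) * Uᴴ - H).PosSemidef := by
  obtain ⟨V, hV⟩ : ∃ V, V = (hH.1.eigenvectorUnitary : Matrix (Fin n) (Fin n) ℂ) := ⟨_, rfl⟩
  obtain ⟨W, hW⟩ : ∃ W, W = (hS.eigenvectorUnitary : Matrix (Fin n) (Fin n) ℂ) := ⟨_, rfl⟩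
  have hVV : Vᴴ * V = 1 := hV ▸ hH.1.conjTranspose_eigenvectorUnitary_mul_self
  have hWW : Wᴴ * W = 1 := hW ▸ hS.conjTranspose_eigenvectorUnitary_mul_self
  have hWW' : W * Wᴴ = 1 := mul_eq_one_comm.1 hWW
  have hHe := hH.1.eq_mul_diagonal_mul
  have hSe := hS.eq_mul_diagonal_mul
  rw [← hV] at hHe
  rw [← hW] at hSe
  have hle (i) : hH.1.eigenvalues i ≤ max (hS.eigenvalues i) 0 := by
    rcases (hH.eigenvalues_nonneg i).eq_or_lt with h0 | h0
    · exact h0 ▸ le_max_right _ _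
    refine le_max_of_le_left (le_of_posSemidef_diagonal_sub (T := Wᴴ * V) ?_ _
      (fun _ _ => hH.1.eigenvalues_le_of_le) (fun _ _ => hS.eigenvalues_le_of_le) ?_ h0)
    · rw [conjTranspose_mul, conjTranspose_conjTranspose, mul_assoc, ← mul_assoc W, hWW',
        one_mul, hVV]
    · convert h.conjTranspose_mul_mul_same V using 1
      have hVH : Vᴴ * H = diagonal (fun i => (hH.1.eigenvalues i : ℂ)) * Vᴴ := by
        conv_lhs => rw [hHe]
        rw [← mul_assoc, ← mul_assoc, hVV, one_mul]
      have hHV : H * V = V * diagonal (fun i => (hH.1.eigenvalues i : ℂ)) := by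
        conv_lhs => rw [hHe]
        rw [mul_assoc, hVV, mul_one]
      have hassoc : Vᴴ * (H * (S - H) * H) * V = Vᴴ * H * (S - H) * (H * V) := by
        simp only [mul_assoc]
      have hVHV : Vᴴ * H * V = diagonal (fun i => (hH.1.eigenvalues i : ℂ)) := by
        rw [hVH, mul_assoc, hVV, mul_one]
      rw [hassoc, hVH, hHV]
      nth_rw 2 [← hVHV]
      conv_rhs => rw [hSe]
      simp only [conjTranspose_mul, conjTranspose_conjTranspose, mul_sub, sub_mul, mul_assoc]
  refine ⟨V * Wᴴ, ?_, ?_⟩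
  · rw [conjTranspose_mul, conjTranspose_conjTranspose, mul_assoc, ← mul_assoc Vᴴ, hVV,
        one_mul, hWW']
  · have hpos := (posSemidef_diagonal_ofReal
      (fun i => sub_nonneg.2 (hle i))).mul_mul_conjTranspose_same V
    convert hpos using 1
    have hfun : matFun S (fun t => max t 0) =
        W * diagonal (fun i => ((max (hS.eigenvalues i) 0 : ℝ) : ℂ)) * Wᴴ := by
      rw [matFun, dif_pos hS, hW]
      rfl
    have hD : diagonal (fun i => ((max (hS.eigenvalues i) 0 - hH.1.eigenvalues i : ℝ) : ℂ)) =
        diagonal (fun i => ((max (hS.eigenvalues i) 0 : ℝ) : ℂ)) -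
          diagonal (fun i => (hH.1.eigenvalues i : ℂ)) := by
      rw [diagonal_sub]
      simp
    rw [hfun, hD, mul_sub, sub_mul, ← hHe, conjTranspose_mul, conjTranspose_conjTranspose]
    congr 1
    calc _ = V * (Wᴴ * W) * diagonal (fun i => ((max (hS.eigenvalues i) 0 : ℝ) : ℂ)) *
          (Wᴴ * W) * Vᴴ := by simp only [mul_assoc]
      _ = _ := by rw [hWW, mul_one, mul_one]

/-- The positive part `C` of `A - β` is carried by a projection `E` with `A ≥ C + β E`. -/
theorem PosSemidef.exists_projection_posPart {A : Matrix (Fin n) (Fin n) ℂ} (hA : A.PosSemidef)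
    (β : ℝ) :
    ∃ E : Matrix (Fin n) (Fin n) ℂ, Eᴴ = E ∧ E * E = E ∧
      E * matFun (A - (β : ℂ) • 1) (fun t => max t 0) =
        matFun (A - (β : ℂ) • 1) (fun t => max t 0) ∧
      (matFun (A - (β : ℂ) • 1) (fun t => max t 0)).PosSemidef ∧
      (A - matFun (A - (β : ℂ) • 1) (fun t => max t 0) - (β : ℂ) • E).PosSemidef := by
  have hB : (A - (β : ℂ) • (1 : Matrix (Fin n) (Fin n) ℂ)).IsHermitian :=
    hA.1.sub (by simp [IsHermitian, conjTranspose_smul])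
  obtain ⟨V, hV⟩ : ∃ V, V = (hB.eigenvectorUnitary : Matrix (Fin n) (Fin n) ℂ) := ⟨_, rfl⟩
  have hVV : Vᴴ * V = 1 := hV ▸ hB.conjTranspose_eigenvectorUnitary_mul_self
  have hVV' : V * Vᴴ = 1 := mul_eq_one_comm.1 hVV
  have hBe := hB.eq_mul_diagonal_mul
  have hfun : matFun (A - (β : ℂ) • 1) (fun t => max t 0) =
      V * diagonal (fun i => ((max (hB.eigenvalues i) 0 : ℝ) : ℂ)) * Vᴴ := by
    rw [matFun, dif_pos hB, hV]
    rfl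
  rw [hfun]
  rw [← hV] at hBe
  generalize hB.eigenvalues = d at hBe
  have hmul (X Y : Matrix (Fin n) (Fin n) ℂ) : V * X * Vᴴ * (V * Y * Vᴴ) = V * (X * Y) * Vᴴ := by
    calc _ = V * X * (Vᴴ * V) * Y * Vᴴ := by simp only [mul_assoc]
      _ = _ := by rw [hVV, mul_one, mul_assoc V]
  have hAe : A = V * diagonal (fun i => ((d i + β : ℝ) : ℂ)) * Vᴴ := by
    have hD : diagonal (fun i => ((d i + β : ℝ) : ℂ)) =
        diagonal (fun i => (d i : ℂ)) + (β : ℂ) • (1 : Matrix (Fin n) (Fin n) ℂ) := by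
      rw [smul_one_eq_diagonal, diagonal_add]
      simp
    rw [hD, mul_add, add_mul, ← hBe, mul_smul_comm, mul_one, smul_mul_assoc, hVV', sub_add_cancel]
  have hd (i) : 0 ≤ d i + β := by
    have h := hA.conjTranspose_mul_mul_same V
    rw [hAe] at h
    have hVAV : Vᴴ * (V * diagonal (fun i => ((d i + β : ℝ) : ℂ)) * Vᴴ) * V =
        diagonal (fun i => ((d i + β : ℝ) : ℂ)) := by
      calc _ = (Vᴴ * V) * diagonal (fun i => ((d i + β : ℝ) : ℂ)) * (Vᴴ * V) := by
            simp only [mul_assoc]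
        _ = _ := by rw [hVV, mul_one, one_mul]
    rw [hVAV, posSemidef_diagonal_iff] at h
    exact_mod_cast h i
  refine ⟨V * diagonal (fun i => (((if 0 < d i then 1 else 0) : ℝ) : ℂ)) * Vᴴ, ?_, ?_, ?_, ?_, ?_⟩
  · exact ((posSemidef_diagonal_ofReal fun i => by positivity).mul_mul_conjTranspose_same V).1
  · rw [hmul, diagonal_mul_diagonal]
    congr; ext i
    split_ifs <;> simp
  · rw [hmul, diagonal_mul_diagonal]
    congr; ext i
    split_ifs with h
    · simp
    · simp [not_lt.1 h]
  · exact (posSemidef_diagonal_ofReal fun i => le_max_right _ _).mul_mul_conjTranspose_same V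
  · have hpos : ∀ i, 0 ≤ d i + β - max (d i) 0 - β * (if 0 < d i then 1 else 0) := by
      intro i
      have := hd i
      split_ifs with h
      · rw [max_eq_left h.le]; linarith
      · rw [max_eq_right (not_lt.1 h)]; linarith
    convert (posSemidef_diagonal_ofReal hpos).mul_mul_conjTranspose_same V using 1
    have hD : diagonal (fun i => ((d i + β - max (d i) 0 -
          β * (if 0 < d i then 1 else 0) : ℝ) : ℂ)) =
        diagonal (fun i => ((d i + β : ℝ) : ℂ)) -
          diagonal (fun i => ((max (d i) 0 : ℝ) : ℂ)) -
          (β : ℂ) • diagonal (fun i => (((if 0 < d i then 1 else 0) : ℝ) : ℂ)) := by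
      rw [← diagonal_smul, diagonal_sub, diagonal_sub]
      congr; ext i
      simp only [Pi.smul_apply, smul_eq_mul]
      push_cast
      rfl
    conv_lhs => rw [hAe]
    rw [hD, mul_sub, sub_mul, mul_sub, sub_mul, mul_smul_comm, smul_mul_assoc]

/-- If `E` is a projection and `G ≥ 1` then `E G E G E ≥ E G E`. -/
theorem PosSemidef.compress_sq_sub_compress {G E : Matrix (Fin n) (Fin n) ℂ}
    (hG : (G - 1).PosSemidef) (hE : Eᴴ = E) (hEE : E * E = E) :
    (E * G * E * G * E - E * G * E).PosSemidef := by
  have h := hG.conjTranspose_mul_mul_same E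
  convert (posSemidef_conjTranspose_mul_self (Eᴴ * (G - 1) * E)).add h using 1
  rw [h.1.eq, hE]
  have hEX (X : Matrix (Fin n) (Fin n) ℂ) : E * (E * X) = E * X := by rw [← mul_assoc, hEE]
  simp only [mul_sub, sub_mul, mul_one, mul_assoc, hEE, hEX]
  abel

end Matrix

/-- for a positive semidefinite `A`, an expansive `Z` and `β ≥ 0`,
there is a unitary `U` with `Zᴴ (A - βI)₊ Z ≤ U (ZᴴAZ - βI)₊ Uᴴ`. -/
theorem positive_part_expansive {n : ℕ}
    (A : Matrix (Fin n) (Fin n) ℂ) (hA : A.PosSemidef)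
    (Z : Matrix (Fin n) (Fin n) ℂ) (hZ : (Zᴴ * Z - 1).PosSemidef)
    (β : ℝ) (hβ : 0 ≤ β) :
    ∃ U : Matrix (Fin n) (Fin n) ℂ, Uᴴ * U = 1 ∧
      (U * matFun (Zᴴ * A * Z - (β : ℂ) • 1) (fun t => max t 0) * Uᴴ -
        Zᴴ * matFun (A - (β : ℂ) • 1) (fun t => max t 0) * Z).PosSemidef := by
  obtain ⟨E, hE, hEE, hEC, hC, hAC⟩ := hA.exists_projection_posPart β
  generalize matFun (A - (β : ℂ) • 1) (fun t => max t 0) = C at hEC hC hAC ⊢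
  have hCE : C * E = C := by
    simpa [conjTranspose_mul, hE, hC.1.eq] using congr_arg conjTranspose hEC
  have hS : (Zᴴ * A * Z - (β : ℂ) • (1 : Matrix (Fin n) (Fin n) ℂ)).IsHermitian :=
    (hA.conjTranspose_mul_mul_same Z).1.sub (by simp [IsHermitian, conjTranspose_smul])
  refine exists_unitary_conj_posPart_sub hS (hC.conjTranspose_mul_mul_same Z) ?_
  have hcomp := ((hZ.mul_conjTranspose_sub_one.compress_sq_sub_compress hE hEE).smul
    (by exact_mod_cast hβ : (0 : ℂ) ≤ β)).conjTranspose_mul_mul_same (C * Z)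
  have hrest := hAC.conjTranspose_mul_mul_same (Z * (Zᴴ * C * Z))
  convert hcomp.add hrest using 1
  have hCEX (X : Matrix (Fin n) (Fin n) ℂ) : C * (E * X) = C * X := by rw [← mul_assoc, hCE]
  have hECX (X : Matrix (Fin n) (Fin n) ℂ) : E * (C * X) = C * X := by rw [← mul_assoc, hEC]
  simp only [conjTranspose_mul, conjTranspose_conjTranspose, hC.1.eq, mul_sub, sub_mul, smul_sub,
    mul_smul_comm, smul_mul_assoc, mul_one, mul_assoc, hCEX, hECX]
  abel
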